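/- arXiv:2405.11727 — 2 statements merged into one kernel-verified Lean document; each statement's English description precedes it below -/
import Mathlib

section
/- The highway value-update operator with edge-length-dependent discounting is a max-norm γ-contraction: for every w, v : S_inter → ℝ, d(H w, H v) ≤ γ · d(w, v), where H(V)(i) = max_{j ∈ Γ(i)} (γ^{ℓ(i,j)} · V j + r_h(i,j)) and each highway length ℓ(i,j) is a positive natural number. -/
/-- The highway value-update operator
`H V i = max_{j ∈ Γ i} (γ^(ℓ i j) * V j + r_h i j)`, where each highway length
`ℓ i j` is a positive natural number, is a max-norm `γ`-contraction:
`d (H w) (H v) ≤ γ * d w v`. -/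
theorem highway_operator_contraction
    {S : Type*} [Fintype S] [Nonempty S]
    (Γ : S → Finset S) (hΓ : ∀ i, (Γ i).Nonempty)
    (ℓ : S → S → ℕ) (hℓ : ∀ i j, 1 ≤ ℓ i j)
    (rh : S → S → ℝ) (γ : ℝ) (hγ0 : 0 ≤ γ) (hγ1 : γ < 1)
    (H : (S → ℝ) → (S → ℝ))
    (hH : ∀ (V : S → ℝ) (i : S),
      H V i = (Γ i).sup' (hΓ i) (fun j => γ ^ (ℓ i j) * V j + rh i j))
    (d : (S → ℝ) → (S → ℝ) → ℝ)
    (hd : ∀ w v : S → ℝ,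
      d w v = Finset.univ.sup' Finset.univ_nonempty (fun i => |w i - v i|))
    (w v : S → ℝ) :
    d (H w) (H v) ≤ γ * d w v := by
  have hstep (a b : S → ℝ) (i j : S) :
      γ ^ ℓ i j * a j + rh i j ≤ γ ^ ℓ i j * b j + rh i j + γ * d a b := by
    have hab : |a j - b j| ≤ d a b := by
      rw [hd]
      exact Finset.le_sup' (fun i => |a i - b i|) (Finset.mem_univ j)
    have hpow : γ ^ ℓ i j ≤ γ :=
      pow_le_of_le_one hγ0 hγ1.le (Nat.one_le_iff_ne_zero.mp (hℓ i j))
    have hmul : γ ^ ℓ i j * (a j - b j) ≤ γ * d a b :=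
      calc γ ^ ℓ i j * (a j - b j) ≤ γ ^ ℓ i j * |a j - b j| :=
            mul_le_mul_of_nonneg_left (le_abs_self _) (pow_nonneg hγ0 _)
        _ ≤ γ * d a b := mul_le_mul hpow hab (abs_nonneg _) hγ0
    linarith
  have hH_le (a b : S → ℝ) (i : S) : H a i ≤ H b i + γ * d a b := by
    rw [hH a, hH b]
    refine Finset.sup'_le _ _ fun j hj => (hstep a b i j).trans ?_
    gcongr
    exact Finset.le_sup' (fun j => γ ^ ℓ i j * b j + rh i j) hj
  have hd_comm : d v w = d w v := by
    simp only [hd, abs_sub_comm]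
  rw [hd (H w)]
  refine Finset.sup'_le _ _ fun i _ => abs_sub_le_iff.mpr ⟨?_, ?_⟩
  · linarith [hH_le w v i]
  · have := hH_le v w i
    rw [hd_comm] at this
    linarith
end

section
/- Highway-graph value iteration converges to a unique optimal value function: the sequence V^(u) defined by V^(0) = 0 and V^(u)(i) = max_{j ∈ Γ(i)} (γ^{ℓ(i,j)} · V^(u−1)(j) + r_h(i,j)) converges in the sup metric, as u → ∞, to the unique V* : S_inter → ℝ satisfying V*(i) = max_{j ∈ Γ(i)} (γ^{ℓ(i,j)} · V*(j) + r_h(i,j)) for all i ∈ S_inter. -/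
theorem Finset.abs_sup'_sub_sup'_le {α : Type*} {s : Finset α} (hs : s.Nonempty)
    {f g : α → ℝ} {c : ℝ} (h : ∀ a ∈ s, |f a - g a| ≤ c) :
    |s.sup' hs f - s.sup' hs g| ≤ c := by
  rw [abs_sub_le_iff, sub_le_iff_le_add, sub_le_iff_le_add]
  constructor <;> refine Finset.sup'_le hs _ fun a ha => ?_
  · linarith [(abs_sub_le_iff.mp (h a ha)).1, Finset.le_sup' g ha]
  · linarith [(abs_sub_le_iff.mp (h a ha)).2, Finset.le_sup' f ha]

theorem dist_eq_sup'_abs_sub {S : Type*} [Fintype S] [Nonempty S] (w v : S → ℝ) :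
    dist w v = Finset.univ.sup' Finset.univ_nonempty (fun i => |w i - v i|) := by
  apply le_antisymm
  · exact dist_pi_le_iff'.mpr fun i =>
      Finset.le_sup' (fun i => |w i - v i|) (Finset.mem_univ i)
  · exact Finset.sup'_le _ _ fun i _ => dist_le_pi_dist w v i

/-- The Bellman operator of a highway graph. -/
noncomputable def highwayBellman {S : Type*} (Γ : S → Finset S) (hΓ : ∀ i, (Γ i).Nonempty)
    (ℓ : S → S → ℕ) (rh : S → S → ℝ) (γ : ℝ) (v : S → ℝ) : S → ℝ :=
  fun i => (Γ i).sup' (hΓ i) (fun j => γ ^ (ℓ i j) * v j + rh i j)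

theorem contractingWith_highwayBellman {S : Type*} [Fintype S]
    (Γ : S → Finset S) (hΓ : ∀ i, (Γ i).Nonempty)
    (ℓ : S → S → ℕ) (hℓ : ∀ i j, 1 ≤ ℓ i j)
    (rh : S → S → ℝ) (γ : ℝ) (hγ0 : 0 ≤ γ) (hγ1 : γ < 1) :
    ContractingWith ⟨γ, hγ0⟩ (highwayBellman Γ hΓ ℓ rh γ) := by
  refine ⟨hγ1, LipschitzWith.of_dist_le_mul fun v w => ?_⟩
  refine (dist_pi_le_iff (mul_nonneg hγ0 dist_nonneg)).mpr fun i =>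
    Finset.abs_sup'_sub_sup'_le (hΓ i) fun j _ => ?_
  rw [add_sub_add_right_eq_sub, ← mul_sub, abs_mul, abs_of_nonneg (pow_nonneg hγ0 _)]
  exact mul_le_mul (pow_le_of_le_one hγ0 hγ1.le (Nat.one_le_iff_ne_zero.mp (hℓ i j)))
    (dist_le_pi_dist v w j) (abs_nonneg _) hγ0

/-- Highway-graph value iteration converges to a unique optimal value function:
the sequence `V 0 = 0`, `V (u+1) i = max_{j ∈ Γ i} (γ^(ℓ i j) * V u j + r_h i j)`
converges in the sup metric to the unique `V*` satisfying
`V* i = max_{j ∈ Γ i} (γ^(ℓ i j) * V* j + r_h i j)` for all `i`. -/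
theorem highway_value_iteration_converges
    {S : Type*} [Fintype S] [Nonempty S]
    (Γ : S → Finset S) (hΓ : ∀ i, (Γ i).Nonempty)
    (ℓ : S → S → ℕ) (hℓ : ∀ i j, 1 ≤ ℓ i j)
    (rh : S → S → ℝ) (γ : ℝ) (hγ0 : 0 ≤ γ) (hγ1 : γ < 1)
    (d : (S → ℝ) → (S → ℝ) → ℝ)
    (hd : ∀ w v : S → ℝ,
      d w v = Finset.univ.sup' Finset.univ_nonempty (fun i => |w i - v i|))
    (V : ℕ → S → ℝ)
    (hV0 : V 0 = fun _ => 0)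
    (hVsucc : ∀ (u : ℕ) (i : S),
      V (u + 1) i = (Γ i).sup' (hΓ i) (fun j => γ ^ (ℓ i j) * V u j + rh i j)) :
    ∃ Vstar : S → ℝ,
      (∀ i : S,
        Vstar i = (Γ i).sup' (hΓ i) (fun j => γ ^ (ℓ i j) * Vstar j + rh i j)) ∧
      (∀ W : S → ℝ,
        (∀ i : S,
          W i = (Γ i).sup' (hΓ i) (fun j => γ ^ (ℓ i j) * W j + rh i j)) →
        W = Vstar) ∧
      Filter.Tendsto (fun u : ℕ => d (V u) Vstar) Filter.atTop (nhds 0) := by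
  have hc := contractingWith_highwayBellman Γ hΓ ℓ hℓ rh γ hγ0 hγ1
  set T := highwayBellman Γ hΓ ℓ rh γ
  have hV : ∀ u, V u = T^[u] (V 0) := by
    intro u
    induction u with
    | zero => rfl
    | succ u ih =>
      rw [Function.iterate_succ_apply', ← ih]
      exact funext (hVsucc u)
  refine ⟨hc.fixedPoint T, fun i => (congrFun hc.fixedPoint_isFixedPt i).symm,
    fun W hW => hc.fixedPoint_unique (funext hW).symm, ?_⟩
  have hlim := tendsto_iff_dist_tendsto_zero.mp (hc.tendsto_iterate_fixedPoint (V 0))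
  simpa only [hd, ← dist_eq_sup'_abs_sub, ← hV] using hlim
end
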